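/- Let R be a commutative ring, a ∈ R, and t a positive integer. The polynomial ring R[x] is a^t-reduced (as a module over itself via the image of a) if and only if R is a^t-reduced; equivalently, a^t·Γ_a(R[x]) = (a^t·Γ_a(R))[x], the set of polynomials all of whose coefficients lie in a^t·Γ_a(R). -/

import Mathlib

open Pointwise

/-- The `a`-torsion submodule `Γ_a(M) = {m | ∃ k ≥ 1, a^k • m = 0}`. -/
def aTorsion (R : Type*) [CommRing R] (a : R) (M : Type*) [AddCommGroup M]
    [Module R M] : Submodule R M :=
  ⨆ k : ℕ, Submodule.torsionBy R M (a ^ (k + 1))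

/-- The generalised locally nilradical `a^t • Γ_a(M)`. -/
def genLocNil (R : Type*) [CommRing R] (a : R) (t : ℕ) (M : Type*)
    [AddCommGroup M] [Module R M] : Submodule R M :=
  a ^ t • aTorsion R a M

theorem mem_aTorsion_iff {R : Type*} [CommRing R] {a : R} {M : Type*} [AddCommGroup M]
    [Module R M] {m : M} : m ∈ aTorsion R a M ↔ ∃ k : ℕ, a ^ (k + 1) • m = 0 := by
  have hmono : Monotone fun k : ℕ => Submodule.torsionBy R M (a ^ (k + 1)) :=
    fun _ _ hkl => Submodule.torsionBy_le_torsionBy_of_dvd _ _ (pow_dvd_pow a (by omega))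
  simp [aTorsion, Submodule.mem_iSup_of_directed _ hmono.directed_le]

theorem mem_genLocNil_iff {R : Type*} [CommRing R] {a : R} {t : ℕ} {M : Type*}
    [AddCommGroup M] [Module R M] {m : M} :
    m ∈ genLocNil R a t M ↔ ∃ x : M, (∃ k : ℕ, a ^ (k + 1) • x = 0) ∧ a ^ t • x = m := by
  simp [genLocNil, Submodule.mem_smul_pointwise_iff_exists, mem_aTorsion_iff]

theorem mem_genLocNil_polynomial_iff {R : Type*} [CommRing R] {a : R} {t : ℕ}
    {p : Polynomial R} :
    p ∈ genLocNil (Polynomial R) (Polynomial.C a) t (Polynomial R) ↔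
      ∀ n : ℕ, p.coeff n ∈ genLocNil R a t R := by
  constructor
  · intro hp n
    obtain ⟨q, ⟨k, hq⟩, rfl⟩ := mem_genLocNil_iff.1 hp
    refine mem_genLocNil_iff.2 ⟨q.coeff n, ⟨k, ?_⟩, ?_⟩
    · simpa only [smul_eq_mul, ← Polynomial.C_pow, Polynomial.coeff_C_mul, Polynomial.coeff_zero]
        using congrArg (Polynomial.coeff · n) hq
    · simp only [smul_eq_mul, ← Polynomial.C_pow, Polynomial.coeff_C_mul]
  · intro hp
    rw [p.as_sum_support]
    refine Submodule.sum_mem _ fun n _ => ?_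
    obtain ⟨r, ⟨k, hr⟩, hrp⟩ := mem_genLocNil_iff.1 (hp n)
    rw [smul_eq_mul] at hr hrp
    refine mem_genLocNil_iff.2 ⟨Polynomial.monomial n r, ⟨k, ?_⟩, ?_⟩
    · rw [smul_eq_mul, ← Polynomial.C_pow, Polynomial.C_mul_monomial, hr, map_zero]
    · rw [smul_eq_mul, ← Polynomial.C_pow, Polynomial.C_mul_monomial, hrp]

/-- `a^t • Γ_a(R[x]) = (a^t • Γ_a(R))[x]` (coefficientwise), and
consequently `R[x]` is `a^t`-reduced iff `R` is. -/
theorem stmt_19 {R : Type*} [CommRing R] (a : R) (t : ℕ) (ht : 1 ≤ t) :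
    (∀ p : Polynomial R,
      p ∈ genLocNil (Polynomial R) (Polynomial.C a) t (Polynomial R) ↔
        ∀ n : ℕ, p.coeff n ∈ genLocNil R a t R) ∧
    (genLocNil (Polynomial R) (Polynomial.C a) t (Polynomial R) = ⊥ ↔
      genLocNil R a t R = ⊥) := by
  refine ⟨fun _ => mem_genLocNil_polynomial_iff, ?_⟩
  simp only [Submodule.eq_bot_iff]
  constructor
  · intro h r hr
    refine Polynomial.C_eq_zero.1 (h _ (mem_genLocNil_polynomial_iff.2 fun n => ?_))
    rw [Polynomial.coeff_C]
    split_ifs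
    exacts [hr, Submodule.zero_mem _]
  · intro h p hp
    ext n
    exact h _ (mem_genLocNil_polynomial_iff.1 hp n)
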